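/- There exists a family of polynomials ι_n (n ≥ 1), each with integer coefficients in the variables q and x_1, …, x_n, such that for every positive integer n the identity ∑_{d|n} d·q^{n/d − 1}·ι_d^{n/d} = − ∑_{d|n} d·q^{n/d − 1}·x_d^{n/d} holds in the polynomial ring ℤ[q, x_1, x_2, …]. -/

import Mathlib

open Finset MvPolynomial

/-- Variables of the polynomial ring `ℤ[q, x₁, x₂, …]`. -/
abbrev NVar : Type := Unit ⊕ ℕ

/-- The variable `q`. -/
def qVar : NVar := Sum.inl ()

/-- The variable `x_d`. -/
def xVar (d : ℕ) : NVar := Sum.inr d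

/-- The `n`-th component of the ghost map of the universal Witt ring. -/
def ghostComponent {R : Type*} [CommSemiring R] (y : ℕ → R) (n : ℕ) : R :=
  ∑ d ∈ n.divisors, (d : R) * y d ^ (n / d)

theorem prime_pow_dvd_mul_pow_sub_pow {R : Type*} [CommRing R] {p : ℕ} (hp : p.Prime)
    {a b : R} (hab : (p : R) ∣ a - b) {k d m : ℕ} (hd : d ≠ 0) (hm : m ≠ 0)
    (h : p ^ k ∣ p * (d * m)) : (p : R) ^ k ∣ (d : R) * (a ^ m - b ^ m) := by
  obtain ⟨i, d', hd', rfl⟩ := Nat.exists_eq_pow_mul_and_not_dvd hd p hp.ne_one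
  obtain ⟨j, m', hm', rfl⟩ := Nat.exists_eq_pow_mul_and_not_dvd hm p hp.ne_one
  have hcop : Nat.Coprime (p ^ k) (d' * m') :=
    Nat.Coprime.pow_left k (((Nat.Prime.coprime_iff_not_dvd hp).2 hd').mul_right
      ((Nat.Prime.coprime_iff_not_dvd hp).2 hm'))
  have hk : p ^ k ∣ p ^ (i + (j + 1)) := by
    refine hcop.dvd_of_dvd_mul_right (h.trans (dvd_of_eq ?_))
    ring
  have hpow : (p : R) ^ (j + 1) ∣ a ^ (p ^ j * m') - b ^ (p ^ j * m') := by
    rw [pow_mul, pow_mul]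
    exact (dvd_sub_pow_of_dvd_sub hab j).trans (sub_dvd_pow_sub_pow _ _ m')
  calc (p : R) ^ k ∣ (p : R) ^ (i + (j + 1)) := by exact_mod_cast Nat.cast_dvd_cast (α := R) hk
    _ = (p : R) ^ i * (p : R) ^ (j + 1) := pow_add _ _ _
    _ ∣ _ := mul_dvd_mul (by push_cast; exact dvd_mul_right _ _) hpow

theorem MvPolynomial.natCast_dvd_pow_sub_expand {σ : Type*} {p : ℕ} (hp : p.Prime)
    (f : MvPolynomial σ ℤ) : (p : MvPolynomial σ ℤ) ∣ f ^ p - expand p f := by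
  have := Fact.mk hp
  have h := (C_dvd_iff_zmod p (f ^ p - expand p f)).2 (by
    rw [map_sub, map_pow, map_expand, expand_zmod, sub_self])
  simpa using h

/-- Dwork's congruence for the Frobenius lift `expand p`. -/
theorem prime_pow_dvd_ghostComponent_sub_expand {σ : Type*} {p : ℕ} (hp : p.Prime)
    (y : ℕ → MvPolynomial σ ℤ) {k n : ℕ} (hk : p ^ k ∣ p * n) (hn : n ≠ 0) :
    (p : MvPolynomial σ ℤ) ^ k ∣
      ghostComponent y (p * n) - expand p (ghostComponent y n) := by
  have hsub : n.divisors ⊆ (p * n).divisors :=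
    Nat.divisors_subset_of_dvd (mul_ne_zero hp.ne_zero hn) (dvd_mul_left _ _)
  simp only [ghostComponent]
  rw [← Finset.sum_sdiff hsub, map_sum, add_sub_assoc, ← Finset.sum_sub_distrib]
  refine dvd_add (Finset.dvd_sum fun d hd => ?_) (Finset.dvd_sum fun d hd => ?_)
  · rw [Finset.mem_sdiff, Nat.mem_divisors, Nat.mem_divisors] at hd
    obtain ⟨⟨⟨e, he⟩, -⟩, hdn⟩ := hd
    have hpe : ¬ p ∣ e := by
      rintro ⟨c, rfl⟩
      refine hdn ⟨⟨c, Nat.eq_of_mul_eq_mul_left hp.pos ?_⟩, hn⟩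
      rw [he]; ring
    have hcop : Nat.Coprime (p ^ k) e :=
      Nat.Coprime.pow_left k ((Nat.Prime.coprime_iff_not_dvd hp).2 hpe)
    have hd : p ^ k ∣ d := hcop.dvd_of_dvd_mul_right (he ▸ hk)
    exact Dvd.dvd.mul_right (by exact_mod_cast Nat.cast_dvd_cast (α := MvPolynomial σ ℤ) hd) _
  · obtain ⟨⟨m, rfl⟩, -⟩ := Nat.mem_divisors.1 hd
    have hd0 : d ≠ 0 := left_ne_zero_of_mul hn
    have hm0 : m ≠ 0 := right_ne_zero_of_mul hn
    have h₁ : p * (d * m) / d = p * m := by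
      rw [mul_left_comm, Nat.mul_div_cancel_left _ (Nat.pos_of_ne_zero hd0)]
    rw [h₁, Nat.mul_div_cancel_left _ (Nat.pos_of_ne_zero hd0), map_mul, map_natCast, map_pow,
      ← mul_sub, pow_mul]
    exact prime_pow_dvd_mul_pow_sub_pow hp (natCast_dvd_pow_sub_expand hp _) hd0 hm0 hk

theorem MvPolynomial.natCast_dvd_of_prime_pow_dvd {σ : Type*} {n : ℕ} {f : MvPolynomial σ ℤ}
    (h : ∀ p k : ℕ, p.Prime → p ^ k ∣ n → (p : MvPolynomial σ ℤ) ^ k ∣ f) :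
    (n : MvPolynomial σ ℤ) ∣ f := by
  have key (m : ℕ) : (m : MvPolynomial σ ℤ) ∣ f ↔ ∀ i, m ∣ (f.coeff i).natAbs := by
    rw [← map_natCast (C : ℤ →+* MvPolynomial σ ℤ), C_dvd_iff_dvd_coeff]
    simp only [← Int.natCast_dvd]
  refine (key n).2 fun i => (Nat.dvd_iff_prime_pow_dvd_dvd _ _).2 fun p k hp hk => ?_
  exact (key (p ^ k)).1 (by exact_mod_cast h p k hp hk) i

/-- If the ghost components of `y` and `z` are opposite below `n`, then their sum at `n` is
divisible by `n`. -/
theorem natCast_dvd_ghostComponent_add {σ : Type*} (y z : ℕ → MvPolynomial σ ℤ) {n : ℕ}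
    (hn : 0 < n) (h : ∀ m, 0 < m → m < n → ghostComponent y m + ghostComponent z m = 0) :
    (n : MvPolynomial σ ℤ) ∣ ghostComponent y n + ghostComponent z n := by
  refine natCast_dvd_of_prime_pow_dvd fun p k hp hk => ?_
  rcases Nat.eq_zero_or_pos k with rfl | hk0
  · simp
  obtain ⟨m, rfl⟩ := (dvd_pow_self p hk0.ne').trans hk
  have hm : 0 < m := Nat.pos_of_mul_pos_left hn
  have hy := prime_pow_dvd_ghostComponent_sub_expand hp y hk hm.ne'
  have hz := prime_pow_dvd_ghostComponent_sub_expand hp z hk hm.ne'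
  have h0 := congrArg (expand p) (h m hm (lt_mul_of_one_lt_left hm hp.one_lt))
  rw [map_add, map_zero] at h0
  have hadd := dvd_add hy hz
  rwa [sub_add_sub_comm, h0, sub_zero] at hadd

/-- The `n`-th component of the `q`-deformed ghost map. -/
def qGhostComponent {R : Type*} [CommSemiring R] (q : R) (y : ℕ → R) (n : ℕ) : R :=
  ∑ d ∈ n.divisors, (d : R) * q ^ (n / d - 1) * y d ^ (n / d)

theorem mul_qGhostComponent {R : Type*} [CommSemiring R] (q : R) (y : ℕ → R) (n : ℕ) :
    q * qGhostComponent q y n = ghostComponent (fun d => q * y d) n := by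
  rw [qGhostComponent, ghostComponent, Finset.mul_sum]
  refine Finset.sum_congr rfl fun d hd => ?_
  have h : n / d - 1 + 1 = n / d :=
    Nat.sub_add_cancel (Nat.div_pos (Nat.divisor_le hd) (Nat.pos_of_mem_divisors hd))
  rw [mul_pow]
  nth_rw 3 [← h]
  rw [pow_succ]
  ring

theorem MvPolynomial.natCast_dvd_of_dvd_X_mul {σ : Type*} {n : ℕ} {i : σ}
    {f : MvPolynomial σ ℤ} (h : (n : MvPolynomial σ ℤ) ∣ X i * f) :
    (n : MvPolynomial σ ℤ) ∣ f := by
  rw [← map_natCast (C : ℤ →+* MvPolynomial σ ℤ), C_dvd_iff_dvd_coeff] at h ⊢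
  intro m
  exact (coeff_X_mul m i f) ▸ h (Finsupp.single i 1 + m)

theorem natCast_dvd_qGhostComponent_add {σ : Type*} (i : σ) (y z : ℕ → MvPolynomial σ ℤ) {n : ℕ}
    (hn : 0 < n)
    (h : ∀ m, 0 < m → m < n → qGhostComponent (X i) y m + qGhostComponent (X i) z m = 0) :
    (n : MvPolynomial σ ℤ) ∣ qGhostComponent (X i) y n + qGhostComponent (X i) z n := by
  refine natCast_dvd_of_dvd_X_mul (i := i) ?_
  rw [mul_add, mul_qGhostComponent, mul_qGhostComponent]
  refine natCast_dvd_ghostComponent_add _ _ hn fun m hm hmn => ?_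
  rw [← mul_qGhostComponent, ← mul_qGhostComponent, ← mul_add, h m hm hmn, mul_zero]

theorem qGhostComponent_eq_sum_properDivisors_add {R : Type*} [CommSemiring R] (q : R)
    (y : ℕ → R) {n : ℕ} (hn : 0 < n) :
    qGhostComponent q y n =
      ∑ d ∈ n.properDivisors, (d : R) * q ^ (n / d - 1) * y d ^ (n / d) + n * y n := by
  rw [qGhostComponent, ← Nat.insert_self_properDivisors hn.ne',
    Finset.sum_insert Nat.self_notMem_properDivisors, Nat.div_self hn, add_comm]
  simp

/-- The additive-inverse sequence of `x` for the `q`-deformed ghost map. -/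
noncomputable def qWittNeg {R : Type*} [CommRing R] (q : R) (x : ℕ → R) (n : ℕ) : R :=
  Classical.epsilon fun r =>
    (n : R) * r = -qGhostComponent q x n -
      ∑ d ∈ n.properDivisors.attach,
        (d.1 : R) * q ^ (n / d.1 - 1) * qWittNeg q x d.1 ^ (n / d.1)
termination_by n
decreasing_by exact (Nat.mem_properDivisors.1 d.2).2

theorem natCast_mul_qWittNeg {R : Type*} [CommRing R] (q : R) (x : ℕ → R) (n : ℕ)
    (h : (n : R) ∣ -qGhostComponent q x n -
      ∑ d ∈ n.properDivisors, (d : R) * q ^ (n / d - 1) * qWittNeg q x d ^ (n / d)) :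
    (n : R) * qWittNeg q x n = -qGhostComponent q x n -
      ∑ d ∈ n.properDivisors, (d : R) * q ^ (n / d - 1) * qWittNeg q x d ^ (n / d) := by
  rw [← Finset.sum_attach] at h ⊢
  obtain ⟨r, hr⟩ := h
  rw [qWittNeg]
  exact Classical.epsilon_spec (p := fun r => (n : R) * r = _) ⟨r, hr.symm⟩

theorem qGhostComponent_add_qWittNeg {σ : Type*} (i : σ) (x : ℕ → MvPolynomial σ ℤ) (n : ℕ)
    (hn : 0 < n) :
    qGhostComponent (X i) x n + qGhostComponent (X i) (qWittNeg (X i) x) n = 0 := by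
  induction n using Nat.strong_induction_on with
  | _ n ih =>
    have hdvd := natCast_dvd_qGhostComponent_add i x (qWittNeg (X i) x) hn
      fun m hm hmn => ih m hmn hm
    rw [qGhostComponent_eq_sum_properDivisors_add _ (qWittNeg _ _) hn, ← add_assoc,
      dvd_add_left (dvd_mul_right _ _)] at hdvd
    have h := natCast_mul_qWittNeg (X i) x n (by
      rw [← neg_add']
      exact (dvd_neg).2 hdvd)
    rw [qGhostComponent_eq_sum_properDivisors_add _ (qWittNeg _ _) hn, h]
    ring

theorem qWittNeg_mem_supported {σ : Type*} (i : σ) (x : ℕ → MvPolynomial σ ℤ) (s : Set σ)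
    (hi : i ∈ s) (n : ℕ) (hn : 0 < n) (hx : ∀ d ∈ n.divisors, x d ∈ supported ℤ s) :
    qWittNeg (X i) x n ∈ supported ℤ s := by
  induction n using Nat.strong_induction_on with
  | _ n ih =>
    have hX : (X i : MvPolynomial σ ℤ) ∈ supported ℤ s := X_mem_supported.2 hi
    have h := qGhostComponent_add_qWittNeg i x n hn
    rw [qGhostComponent_eq_sum_properDivisors_add _ (qWittNeg _ _) hn, ← add_assoc,
      add_eq_zero_iff_neg_eq] at h
    have hmem : (n : MvPolynomial σ ℤ) * qWittNeg (X i) x n ∈ supported ℤ s := by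
      rw [← h]
      refine neg_mem (add_mem (sum_mem fun d hd => ?_) (sum_mem fun d hd => ?_))
      · exact mul_mem (mul_mem (natCast_mem _ d) (pow_mem hX _)) (pow_mem (hx d hd) _)
      · obtain ⟨hdn, hlt⟩ := Nat.mem_properDivisors.1 hd
        exact mul_mem (mul_mem (natCast_mem _ d) (pow_mem hX _)) (pow_mem
          (ih d hlt (Nat.pos_of_dvd_of_pos hdn hn) fun e he =>
            hx e (Nat.divisors_subset_of_dvd hn.ne' hdn he)) _)
    rwa [← map_natCast (C : ℤ →+* MvPolynomial σ ℤ), mem_supported,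
      vars_C_mul _ (Int.natCast_ne_zero.2 hn.ne'), ← mem_supported] at hmem

/-- There is a family of integral polynomials `ι_n` in `q` and the variables `x_1, …, x_n`
such that `∑_{d|n} d·q^{n/d−1}·ι_d^{n/d} = − ∑_{d|n} d·q^{n/d−1}·x_d^{n/d}`
for every `n ≥ 1`: the additive-inverse polynomials of the `q`-deformed Witt ring. -/
theorem qWitt_neg_polynomials :
    ∃ ι : ℕ → MvPolynomial NVar ℤ,
      (∀ n : ℕ, 0 < n → ∀ v ∈ (ι n).vars,
        v = qVar ∨ ∃ d : ℕ, 1 ≤ d ∧ d ≤ n ∧ v = xVar d) ∧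
      (∀ n : ℕ, 0 < n →
        ∑ d ∈ n.divisors, C (d : ℤ) * X qVar ^ (n / d - 1) * ι d ^ (n / d)
          = - ∑ d ∈ n.divisors, C (d : ℤ) * X qVar ^ (n / d - 1) * X (xVar d) ^ (n / d)) := by
  refine ⟨qWittNeg (X qVar) fun d => X (xVar d), fun n hn v hv => ?_, fun n hn => ?_⟩
  · exact mem_supported.1 (qWittNeg_mem_supported qVar (fun d => X (xVar d))
      {v | v = qVar ∨ ∃ d : ℕ, 1 ≤ d ∧ d ≤ n ∧ v = xVar d} (Or.inl rfl) n hn fun d hd =>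
        X_mem_supported.2 (Or.inr ⟨d, Nat.pos_of_mem_divisors hd, Nat.divisor_le hd, rfl⟩)) hv
  · simpa [qGhostComponent] using
      eq_neg_of_add_eq_zero_right (qGhostComponent_add_qWittNeg qVar (fun d => X (xVar d)) n hn)
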